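/- arXiv:1404.0525 — 2 statements merged into one kernel-verified Lean document; each statement's English description precedes it below -/
import Mathlib

section
/- (Peres–Horodecki criterion for two qubits via the determinant.) Let ρ be a two-qubit density matrix, i.e. a 4×4 complex positive semidefinite matrix with trace 1, written in 2×2 blocks as ρ = [[A, B], [C, D]], and let ρ^Γ = [[Aᵀ, Bᵀ], [Cᵀ, Dᵀ]] be its partial transpose on the second qubit. Then ρ is separable if and only if det(ρ^Γ) ≥ 0, where ρ is called separable if it can be written as a finite convex combination ρ = Σᵢ pᵢ αᵢ ⊗ βᵢ with pᵢ ≥ 0, Σᵢ pᵢ = 1, each αᵢ and βᵢ a 2×2 complex positive semidefinite matrix of trace 1, and ⊗ the Kronecker product. -/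
open Matrix Kronecker
open scoped ComplexOrder

/-- A 4×4 complex matrix (indexed by `Fin 2 × Fin 2`, the first factor being the
first qubit) is separable if it is a finite convex combination of Kronecker
products of 2×2 positive semidefinite trace-1 matrices. -/
def IsSeparableTwoQubit (ρ : Matrix (Fin 2 × Fin 2) (Fin 2 × Fin 2) ℂ) : Prop :=
  ∃ (n : ℕ) (p : Fin n → ℝ) (α β : Fin n → Matrix (Fin 2) (Fin 2) ℂ),
    (∀ i, 0 ≤ p i) ∧ (∑ i, p i = 1) ∧
    (∀ i, (α i).PosSemidef ∧ (α i).trace = 1) ∧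
    (∀ i, (β i).PosSemidef ∧ (β i).trace = 1) ∧
    ρ = ∑ i, (p i : ℂ) • (α i ⊗ₖ β i)

/-- The partial transpose on the second qubit: writing
`ρ = [[A, B], [C, D]]` in 2×2 blocks (first index = first qubit),
`ρ^Γ = [[Aᵀ, Bᵀ], [Cᵀ, Dᵀ]]`, i.e. `ρ^Γ (i,k) (j,l) = ρ (i,l) (j,k)`. -/
def partialTranspose (ρ : Matrix (Fin 2 × Fin 2) (Fin 2 × Fin 2) ℂ) :
    Matrix (Fin 2 × Fin 2) (Fin 2 × Fin 2) ℂ :=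
  fun x y => ρ (x.1, y.2) (y.1, x.2)

section PosSemidefPencil

variable {n : Type*} [Fintype n]

theorem Matrix.IsHermitian.posSemidef_of_re_nonneg {M : Matrix n n ℂ} (hM : M.IsHermitian)
    (h : ∀ v : n → ℂ, 0 ≤ (star v ⬝ᵥ M *ᵥ v).re) : M.PosSemidef :=
  .of_dotProduct_mulVec_nonneg hM fun v ↦
    Complex.le_def.2 ⟨h v, (hM.im_star_dotProduct_mulVec_self v).symm⟩

theorem Matrix.PosSemidef.re_nonneg {M : Matrix n n ℂ} (hM : M.PosSemidef) (v : n → ℂ) :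
    0 ≤ (star v ⬝ᵥ M *ᵥ v).re :=
  (Complex.le_def.1 (hM.dotProduct_mulVec_nonneg v)).1

theorem re_dotProduct_add_smul_mulVec (A B : Matrix n n ℂ) (t : ℝ) (v : n → ℂ) :
    (star v ⬝ᵥ (A + t • B) *ᵥ v).re =
      (star v ⬝ᵥ A *ᵥ v).re + t * (star v ⬝ᵥ B *ᵥ v).re := by
  simp [add_mulVec, smul_mulVec, dotProduct_add, dotProduct_smul]

theorem abs_re_dotProduct_mulVec_le {S : Matrix n n ℂ} (hS : S.IsHermitian) (v : n → ℂ) :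
    |(star v ⬝ᵥ S *ᵥ v).re| ≤ ∑ i, (∑ j, ‖S i j‖) * ‖v i‖ ^ 2 := by
  have key : ∑ i, ∑ j, ‖S i j‖ * ((‖v i‖ ^ 2 + ‖v j‖ ^ 2) / 2) =
      ∑ i, (∑ j, ‖S i j‖) * ‖v i‖ ^ 2 := by
    have swap : ∑ i, ∑ j, ‖S i j‖ * ‖v j‖ ^ 2 = ∑ i, ∑ j, ‖S i j‖ * ‖v i‖ ^ 2 := by
      rw [Finset.sum_comm]
      refine Finset.sum_congr rfl fun i _ ↦ Finset.sum_congr rfl fun j _ ↦ ?_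
      rw [← hS.apply j i, norm_star]
    calc _ = (∑ i, ∑ j, ‖S i j‖ * ‖v i‖ ^ 2 + ∑ i, ∑ j, ‖S i j‖ * ‖v j‖ ^ 2) / 2 := by
          simp only [← Finset.sum_add_distrib, Finset.sum_div]
          exact Finset.sum_congr rfl fun i _ ↦ Finset.sum_congr rfl fun j _ ↦ by ring
      _ = _ := by rw [swap]; simp only [Finset.sum_mul]; ring
  rw [← key]
  refine (Complex.abs_re_le_norm _).trans ?_
  simp only [dotProduct, mulVec, Finset.mul_sum]
  refine (norm_sum_le _ _).trans (Finset.sum_le_sum fun i _ ↦ ?_)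
  refine (norm_sum_le _ _).trans (Finset.sum_le_sum fun j _ ↦ ?_)
  simp only [norm_mul, Pi.star_apply, norm_star]
  nlinarith [mul_nonneg (norm_nonneg (S i j)) (sq_nonneg (‖v i‖ - ‖v j‖))]

variable [DecidableEq n]

theorem exists_posSemidef_diagonal_add_smul {d : n → ℝ} (hd : ∀ i, 0 ≤ d i) {S : Matrix n n ℂ}
    (hS : S.IsHermitian) (h : ∀ i, d i = 0 → ∀ j, S j i = 0) :
    ∃ ε > 0, ∀ t : ℝ, 0 ≤ t → t ≤ ε →
      (diagonal (fun i ↦ (d i : ℂ)) + t • S).PosSemidef := by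
  obtain ⟨ε, hε, hb⟩ : ∃ ε > 0, ∀ i, ε * (∑ j, ‖S i j‖) ≤ d i := by
    have hR : ∀ i, 0 ≤ ∑ j, ‖S i j‖ := fun i ↦ Finset.sum_nonneg fun j _ ↦ norm_nonneg _
    have loc : ∀ i, ∃ ε > 0, ε * (∑ j, ‖S i j‖) ≤ d i := fun i ↦ by
      rcases (hd i).eq_or_lt with h0 | h0
      · refine ⟨1, one_pos, ?_⟩
        rw [← h0, Finset.sum_eq_zero, mul_zero]
        intro j _
        rw [← hS.apply i j, h i h0.symm j, star_zero, norm_zero]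
      · refine ⟨d i / (∑ j, ‖S i j‖ + 1), by have := hR i; positivity, ?_⟩
        have := hR i
        rw [div_mul_eq_mul_div, div_le_iff₀ (by positivity)]
        nlinarith
    choose e he hle using loc
    cases isEmpty_or_nonempty n
    · exact ⟨1, one_pos, fun i ↦ isEmptyElim i⟩
    · obtain ⟨i₀, hi₀⟩ := Finite.exists_min e
      exact ⟨e i₀, he i₀, fun i ↦
        (mul_le_mul_of_nonneg_right (hi₀ i) (hR i)).trans (hle i)⟩
  refine ⟨ε, hε, fun t ht htε ↦ Matrix.IsHermitian.posSemidef_of_re_nonneg ?_ fun v ↦ ?_⟩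
  · refine IsHermitian.add (by ext i j; by_cases hij : i = j <;> simp [hij, eq_comm])
      (IsSelfAdjoint.smul (.all t) hS)
  · rw [re_dotProduct_add_smul_mulVec]
    have h1 : (star v ⬝ᵥ diagonal (fun i ↦ (d i : ℂ)) *ᵥ v).re = ∑ i, d i * ‖v i‖ ^ 2 := by
      simp only [dotProduct, mulVec_diagonal, Complex.re_sum]
      refine Finset.sum_congr rfl fun i _ ↦ ?_
      rw [mul_left_comm, Pi.star_apply, Complex.star_def, ← Complex.normSq_eq_conj_mul_self,
        ← Complex.ofReal_mul, Complex.ofReal_re, Complex.normSq_eq_norm_sq]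
    have h2 := (abs_le.1 (abs_re_dotProduct_mulVec_le hS v)).1
    have h3 : t * ∑ i, (∑ j, ‖S i j‖) * ‖v i‖ ^ 2 ≤ ∑ i, d i * ‖v i‖ ^ 2 := by
      rw [Finset.mul_sum]
      refine Finset.sum_le_sum fun i _ ↦ ?_
      rw [← mul_assoc]
      refine mul_le_mul_of_nonneg_right (le_trans ?_ (hb i)) (sq_nonneg _)
      exact mul_le_mul_of_nonneg_right htε (Finset.sum_nonneg fun j _ ↦ norm_nonneg _)
    rw [h1]
    nlinarith [mul_le_mul_of_nonneg_left h2 ht]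

theorem Matrix.PosSemidef.exists_add_smul {ρ σ : Matrix n n ℂ} (hρ : ρ.PosSemidef)
    (hσ : σ.IsHermitian) (h : ∀ v, ρ *ᵥ v = 0 → σ *ᵥ v = 0) :
    ∃ ε > 0, ∀ t : ℝ, 0 ≤ t → t ≤ ε → (ρ + t • σ).PosSemidef := by
  set U : Matrix n n ℂ := hρ.1.eigenvectorUnitary.1 with hU
  have hUU : U * Uᴴ = 1 := Unitary.coe_mul_star_self hρ.1.eigenvectorUnitary
  obtain ⟨ε, hε, H⟩ := exists_posSemidef_diagonal_add_smul (d := hρ.1.eigenvalues)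
    hρ.eigenvalues_nonneg (S := Uᴴ * σ * U) (isHermitian_conjTranspose_mul_mul U hσ) (by
      intro i hi j
      have h0 : σ *ᵥ (U.col i) = 0 := h _ (by
        rw [hU, hρ.1.eigenvectorUnitary_col_eq, hρ.1.mulVec_eigenvectorBasis, hi, zero_smul])
      rw [Matrix.mul_assoc, Matrix.mul_apply]
      refine Finset.sum_eq_zero fun k _ ↦ ?_
      have : (σ * U) k i = (σ *ᵥ U.col i) k := rfl
      rw [this, h0, Pi.zero_apply, mul_zero])
  refine ⟨ε, hε, fun t ht htε ↦ ?_⟩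
  have := (H t ht htε).mul_mul_conjTranspose_same U
  convert this using 1
  have hs := hρ.1.spectral_theorem
  rw [Unitary.conjStarAlgAut_apply] at hs
  rw [Matrix.mul_add, Matrix.add_mul, Matrix.mul_smul, Matrix.smul_mul]
  congr 1
  · congr 1
    calc σ = (U * Uᴴ) * σ * (U * Uᴴ) := by rw [hUU, one_mul, mul_one]
      _ = _ := by simp only [Matrix.mul_assoc]

end PosSemidefPencil

section PartialTranspose

theorem partialTranspose_add_smul (ρ σ : Matrix (Fin 2 × Fin 2) (Fin 2 × Fin 2) ℂ) (t : ℝ) :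
    partialTranspose (ρ + t • σ) = partialTranspose ρ + t • partialTranspose σ := rfl

theorem Matrix.IsHermitian.partialTranspose {ρ : Matrix (Fin 2 × Fin 2) (Fin 2 × Fin 2) ℂ}
    (hρ : ρ.IsHermitian) : (partialTranspose ρ).IsHermitian := by
  ext x y
  exact hρ.apply _ _

theorem partialTranspose_kronecker_mul_mul (A B C D : Matrix (Fin 2) (Fin 2) ℂ)
    (ρ : Matrix (Fin 2 × Fin 2) (Fin 2 × Fin 2) ℂ) :
    partialTranspose ((A ⊗ₖ B) * ρ * (C ⊗ₖ D)) =
      (A ⊗ₖ Dᵀ) * partialTranspose ρ * (C ⊗ₖ Bᵀ) := by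
  ext x y
  simp only [partialTranspose, Matrix.mul_apply, kroneckerMap_apply, Fintype.sum_prod_type,
    Fin.sum_univ_two, transpose_apply]
  ring

/-- The coordinates of the product vector `e ⊗ f`. -/
def prodVec (e f : Fin 2 → ℂ) : Fin 2 × Fin 2 → ℂ := fun x ↦ e x.1 * f x.2

theorem dotProduct_partialTranspose_mulVec_prodVec
    (ρ : Matrix (Fin 2 × Fin 2) (Fin 2 × Fin 2) ℂ) (e f : Fin 2 → ℂ) :
    star (prodVec e f) ⬝ᵥ partialTranspose ρ *ᵥ prodVec e f =
      star (prodVec e (star f)) ⬝ᵥ ρ *ᵥ prodVec e (star f) := by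
  simp only [prodVec, partialTranspose, dotProduct, mulVec, Fintype.sum_prod_type,
    Fin.sum_univ_two, Pi.star_apply, star_mul', star_star]
  ring

theorem kronecker_mulVec_prodVec (X Y : Matrix (Fin 2) (Fin 2) ℂ) (e f : Fin 2 → ℂ) :
    (X ⊗ₖ Y) *ᵥ prodVec e f = prodVec (X *ᵥ e) (Y *ᵥ f) := by
  ext x
  simp only [prodVec, mulVec, dotProduct, kroneckerMap_apply, Fintype.sum_prod_type,
    Fin.sum_univ_two]
  ring

/-- A vector whose 2×2 coefficient matrix is singular is a product vector. -/
theorem exists_eq_prodVec {v : Fin 2 × Fin 2 → ℂ}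
    (h : v (0, 0) * v (1, 1) = v (0, 1) * v (1, 0)) : ∃ e f, v = prodVec e f := by
  by_cases h0 : v (0, 0) = 0 ∧ v (0, 1) = 0
  · refine ⟨![0, 1], fun j ↦ v (1, j), ?_⟩
    ext ⟨i, j⟩
    fin_cases i <;> fin_cases j <;> simp [prodVec, h0]
  · by_cases h1 : v (0, 0) = 0
    · have h2 : v (0, 1) ≠ 0 := fun h2 ↦ h0 ⟨h1, h2⟩
      refine ⟨![1, v (1, 1) / v (0, 1)], fun j ↦ v (0, j), ?_⟩
      have h3 : v (1, 0) = 0 := by simpa [h1, h2] using h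
      ext ⟨i, j⟩
      fin_cases i <;> fin_cases j <;> simp [prodVec, h1, h2, h3]
    · refine ⟨![1, v (1, 0) / v (0, 0)], fun j ↦ v (0, j), ?_⟩
      ext ⟨i, j⟩
      fin_cases i <;> fin_cases j <;> simp [prodVec, h1]
      field_simp
      linear_combination h

/-- Every two-dimensional subspace of `ℂ² ⊗ ℂ²` contains a product vector. -/
theorem exists_prodVec_mem_span_pair (v w : Fin 2 × Fin 2 → ℂ) :
    ∃ a b : ℂ, (a ≠ 0 ∨ b ≠ 0) ∧ ∃ e f, a • v + b • w = prodVec e f := by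
  by_cases hw : w (0, 0) * w (1, 1) - w (0, 1) * w (1, 0) = 0
  · refine ⟨0, 1, by simp, exists_eq_prodVec ?_⟩
    simpa using sub_eq_zero.1 hw
  · obtain ⟨b, hb⟩ := exists_quadratic_eq_zero
      (b := v (0, 0) * w (1, 1) + w (0, 0) * v (1, 1) - v (0, 1) * w (1, 0) - w (0, 1) * v (1, 0))
      (c := v (0, 0) * v (1, 1) - v (0, 1) * v (1, 0)) hw (IsAlgClosed.exists_eq_mul_self _)
    refine ⟨1, b, by simp, exists_eq_prodVec ?_⟩
    simp only [Pi.add_apply, Pi.smul_apply, smul_eq_mul]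
    linear_combination hb

end PartialTranspose

section Boundary

variable {n : Type*} [Fintype n]

theorem isClosed_setOf_posSemidef_add_smul {ρ σ : Matrix n n ℂ} (hρ : ρ.IsHermitian)
    (hσ : σ.IsHermitian) : IsClosed {t : ℝ | (ρ + t • σ).PosSemidef} := by
  have : {t : ℝ | (ρ + t • σ).PosSemidef} =
      ⋂ v : n → ℂ, {t | 0 ≤ (star v ⬝ᵥ ρ *ᵥ v).re + t * (star v ⬝ᵥ σ *ᵥ v).re} := by
    ext t
    simp only [Set.mem_ofPred_eq, Set.mem_iInter, ← re_dotProduct_add_smul_mulVec]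
    exact ⟨fun h ↦ h.re_nonneg, fun h ↦ Matrix.IsHermitian.posSemidef_of_re_nonneg
      (hρ.add (IsSelfAdjoint.smul (.all t) hσ)) h⟩
  rw [this]
  exact isClosed_iInter fun v ↦ isClosed_le continuous_const (by fun_prop)

theorem bddAbove_setOf_posSemidef_add_smul {ρ σ : Matrix n n ℂ}
    (hσ : σ.IsHermitian) (hn : ¬ σ.PosSemidef) :
    BddAbove {t : ℝ | (ρ + t • σ).PosSemidef} := by
  obtain ⟨v, hv⟩ : ∃ v : n → ℂ, (star v ⬝ᵥ σ *ᵥ v).re < 0 := by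
    by_contra! h
    exact hn (hσ.posSemidef_of_re_nonneg h)
  refine ⟨(star v ⬝ᵥ ρ *ᵥ v).re / -(star v ⬝ᵥ σ *ᵥ v).re, fun t ht ↦ ?_⟩
  have := ht.re_nonneg v
  rw [re_dotProduct_add_smul_mulVec] at this
  rw [le_div_iff₀ (by linarith)]
  linarith

theorem rank_lt_rank_of_ker {ρ ρ' σ : Matrix n n ℂ} {t : ℝ} (hρ' : ρ' = ρ + t • σ)
    (h : ∀ v, ρ *ᵥ v = 0 → σ *ᵥ v = 0) :
    ρ'.rank ≤ ρ.rank ∧ ((∃ v, ρ' *ᵥ v = 0 ∧ σ *ᵥ v ≠ 0) → ρ'.rank < ρ.rank) := by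
  have hle : LinearMap.ker ρ.mulVecLin ≤ LinearMap.ker ρ'.mulVecLin := fun v hv ↦ by
    simp only [LinearMap.mem_ker, mulVecLin_apply] at hv ⊢
    rw [hρ', add_mulVec, smul_mulVec, hv, h v hv, smul_zero, add_zero]
  have r1 := ρ.mulVecLin.finrank_range_add_finrank_ker
  have r2 := ρ'.mulVecLin.finrank_range_add_finrank_ker
  refine ⟨?_, fun ⟨v, hv, hv'⟩ ↦ ?_⟩
  · have := Submodule.finrank_mono hle
    simp only [Matrix.rank]
    omega
  · have := Submodule.finrank_lt_finrank_of_lt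
      (lt_of_le_of_ne hle fun he ↦ hv' (h v (he.ge (show v ∈ LinearMap.ker _ from hv))))
    simp only [Matrix.rank]
    omega

theorem exists_posSemidef_add_smul_rank_lt {ρ σ : Matrix (Fin 2 × Fin 2) (Fin 2 × Fin 2) ℂ}
    (hρ : ρ.PosSemidef) (hρΓ : (partialTranspose ρ).PosSemidef)
    (hσ : σ.IsHermitian) (hn : ¬ σ.PosSemidef) (h : ∀ v, ρ *ᵥ v = 0 → σ *ᵥ v = 0)
    (hΓ : ∀ v, partialTranspose ρ *ᵥ v = 0 → partialTranspose σ *ᵥ v = 0) :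
    ∃ t : ℝ, 0 < t ∧ (ρ + t • σ).PosSemidef ∧ (partialTranspose (ρ + t • σ)).PosSemidef ∧
      (ρ + t • σ).rank + (partialTranspose (ρ + t • σ)).rank <
        ρ.rank + (partialTranspose ρ).rank := by
  set T : Set ℝ := {t | (ρ + t • σ).PosSemidef} ∩
    {t | (partialTranspose ρ + t • partialTranspose σ).PosSemidef}
  have hT0 : (0 : ℝ) ∈ T := by simp [T, hρ, hρΓ]
  have hTb : BddAbove T := (bddAbove_setOf_posSemidef_add_smul hσ hn).mono Set.inter_subset_left
  have hTc : IsClosed T := (isClosed_setOf_posSemidef_add_smul hρ.1 hσ).inter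
    (isClosed_setOf_posSemidef_add_smul hρΓ.1 hσ.partialTranspose)
  obtain ⟨h1, h2⟩ := hTc.csSup_mem ⟨0, hT0⟩ hTb
  set t := sSup T with ht
  have ht0 : 0 ≤ t := le_csSup hTb hT0
  obtain ⟨hr, hr'⟩ := rank_lt_rank_of_ker (rfl : ρ + t • σ = _) h
  obtain ⟨hs, hs'⟩ := rank_lt_rank_of_ker (partialTranspose_add_smul ρ σ t) hΓ
  have hlt : (ρ + t • σ).rank + (partialTranspose (ρ + t • σ)).rank <
        ρ.rank + (partialTranspose ρ).rank := by
    by_contra hlt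
    have k1 : ∀ v, (ρ + t • σ) *ᵥ v = 0 → σ *ᵥ v = 0 := by
      by_contra! hv
      have := hr' hv
      omega
    have k2 : ∀ v, (partialTranspose ρ + t • partialTranspose σ) *ᵥ v = 0 →
        partialTranspose σ *ᵥ v = 0 := by
      by_contra! hv
      have := hs' hv
      omega
    obtain ⟨ε₁, hε₁, H₁⟩ := h1.exists_add_smul hσ k1
    obtain ⟨ε₂, hε₂, H₂⟩ := h2.exists_add_smul hσ.partialTranspose k2
    have hmem : t + min ε₁ ε₂ ∈ T := by
      refine ⟨?_, ?_⟩
      · have := H₁ (min ε₁ ε₂) (by positivity) (min_le_left _ _)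
        rwa [add_assoc, ← add_smul] at this
      · have := H₂ (min ε₁ ε₂) (by positivity) (min_le_right _ _)
        rwa [add_assoc, ← add_smul] at this
    have := le_csSup hTb hmem
    have := lt_min hε₁ hε₂
    linarith
  refine ⟨t, ht0.lt_of_ne fun h0 ↦ ?_, h1, h2, hlt⟩
  rw [← h0, zero_smul, add_zero] at hlt
  exact hlt.false

end Boundary

section SeparableCone

/-- The cone of finite sums of Kronecker products of positive semidefinite 2×2 matrices. -/
def separableCone : AddSubmonoid (Matrix (Fin 2 × Fin 2) (Fin 2 × Fin 2) ℂ) :=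
  .closure {ρ | ∃ α β : Matrix (Fin 2) (Fin 2) ℂ, α.PosSemidef ∧ β.PosSemidef ∧ ρ = α ⊗ₖ β}

theorem kronecker_mem_separableCone {α β : Matrix (Fin 2) (Fin 2) ℂ} (hα : α.PosSemidef)
    (hβ : β.PosSemidef) : α ⊗ₖ β ∈ separableCone :=
  AddSubmonoid.subset_closure ⟨α, β, hα, hβ, rfl⟩

theorem smul_mem_separableCone {ρ : Matrix (Fin 2 × Fin 2) (Fin 2 × Fin 2) ℂ}
    (hρ : ρ ∈ separableCone) {t : ℝ} (ht : 0 ≤ t) : t • ρ ∈ separableCone := by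
  induction hρ using AddSubmonoid.closure_induction with
  | mem x hx =>
    obtain ⟨α, β, hα, hβ, rfl⟩ := hx
    rw [← smul_kronecker]
    exact kronecker_mem_separableCone (hα.smul ht) hβ
  | zero => simp
  | add x y _ _ hx hy => rw [smul_add]; exact add_mem hx hy

theorem kronecker_mul_mul_mem_separableCone {ρ : Matrix (Fin 2 × Fin 2) (Fin 2 × Fin 2) ℂ}
    (hρ : ρ ∈ separableCone) (X Y : Matrix (Fin 2) (Fin 2) ℂ) :
    (X ⊗ₖ Y)ᴴ * ρ * (X ⊗ₖ Y) ∈ separableCone := by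
  induction hρ using AddSubmonoid.closure_induction with
  | mem x hx =>
    obtain ⟨α, β, hα, hβ, rfl⟩ := hx
    rw [conjTranspose_kronecker, ← mul_kronecker_mul, ← mul_kronecker_mul]
    exact kronecker_mem_separableCone (hα.conjTranspose_mul_mul_same X)
      (hβ.conjTranspose_mul_mul_same Y)
  | zero => simp
  | add x y _ _ hx hy => rw [Matrix.mul_add, Matrix.add_mul]; exact add_mem hx hy

theorem exists_eq_smul_mem_convexHull {ρ : Matrix (Fin 2 × Fin 2) (Fin 2 × Fin 2) ℂ}
    (hρ : ρ ∈ separableCone) : ∃ t : ℝ, 0 ≤ t ∧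
      ∃ σ ∈ convexHull ℝ {σ : Matrix (Fin 2 × Fin 2) (Fin 2 × Fin 2) ℂ |
        ∃ α β : Matrix (Fin 2) (Fin 2) ℂ, (α.PosSemidef ∧ α.trace = 1) ∧
          (β.PosSemidef ∧ β.trace = 1) ∧ σ = α ⊗ₖ β}, ρ = t • σ := by
  set s := {σ : Matrix (Fin 2 × Fin 2) (Fin 2 × Fin 2) ℂ |
        ∃ α β : Matrix (Fin 2) (Fin 2) ℂ, (α.PosSemidef ∧ α.trace = 1) ∧
          (β.PosSemidef ∧ β.trace = 1) ∧ σ = α ⊗ₖ β}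
  have normalize : ∀ α : Matrix (Fin 2) (Fin 2) ℂ, α.PosSemidef →
      ∃ t : ℝ, 0 ≤ t ∧ ∃ α' : Matrix (Fin 2) (Fin 2) ℂ,
        (α'.PosSemidef ∧ α'.trace = 1) ∧ α = t • α' := by
    intro α hα
    obtain ⟨hre, him⟩ := Complex.le_def.1 hα.trace_nonneg
    have htr : α.trace = (α.trace.re : ℂ) := Complex.ext rfl him.symm
    by_cases h0 : α.trace = 0
    · refine ⟨0, le_rfl, diagonal ![1, 0], ⟨.diagonal fun i ↦ ?_, by simp⟩, ?_⟩
      · fin_cases i <;> simp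
      · rw [zero_smul]; exact hα.trace_eq_zero_iff.1 h0
    · have hr : α.trace.re ≠ 0 := fun hr ↦ h0 (by rw [htr, hr, Complex.ofReal_zero])
      refine ⟨α.trace.re, hre, α.trace.re⁻¹ • α, ⟨hα.smul (inv_nonneg.2 hre), ?_⟩, ?_⟩
      · rw [trace_smul, Complex.real_smul, Complex.ofReal_inv, ← htr, inv_mul_cancel₀ h0]
      · rw [smul_smul, mul_inv_cancel₀ hr, one_smul]
  induction hρ using AddSubmonoid.closure_induction with
  | mem x hx =>
    obtain ⟨α, β, hα, hβ, rfl⟩ := hx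
    obtain ⟨a, ha, α', hα', rfl⟩ := normalize α hα
    obtain ⟨b, hb, β', hβ', rfl⟩ := normalize β hβ
    refine ⟨a * b, mul_nonneg ha hb, α' ⊗ₖ β', subset_convexHull ℝ s ⟨α', β', hα', hβ', rfl⟩, ?_⟩
    rw [smul_kronecker, kronecker_smul, smul_smul]
  | zero =>
    obtain ⟨-, -, α, hα, -⟩ := normalize 0 .zero
    exact ⟨0, le_rfl, α ⊗ₖ α, subset_convexHull ℝ s ⟨α, α, hα, hα, rfl⟩, by simp⟩
  | add x y _ _ hx hy =>
    obtain ⟨a, ha, σ, hσ, rfl⟩ := hx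
    obtain ⟨b, hb, τ, hτ, rfl⟩ := hy
    rcases (add_nonneg ha hb).eq_or_lt with h | h
    · obtain rfl : a = 0 := by linarith
      obtain rfl : b = 0 := by linarith
      exact ⟨0, le_rfl, σ, hσ, by simp⟩
    · refine ⟨a + b, h.le, (a / (a + b)) • σ + (b / (a + b)) • τ,
        convex_convexHull ℝ s hσ hτ (by positivity) (by positivity) (by field_simp), ?_⟩
      rw [smul_add, smul_smul, smul_smul, mul_div_cancel₀ _ h.ne', mul_div_cancel₀ _ h.ne']

theorem isSeparableTwoQubit_of_mem_separableCone
    {ρ : Matrix (Fin 2 × Fin 2) (Fin 2 × Fin 2) ℂ} (hρ : ρ ∈ separableCone)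
    (hτ : ρ.trace = 1) : IsSeparableTwoQubit ρ := by
  obtain ⟨t, -, σ, hσ, rfl⟩ := exists_eq_smul_mem_convexHull hρ
  obtain ⟨ι, _, w, z, hw, hw1, hz, rfl⟩ := mem_convexHull_iff_exists_fintype.1 hσ
  choose α β hα hβ hαβ using hz
  have ht : t = 1 := by
    have : ∀ i, (z i).trace = 1 := fun i ↦ by
      rw [hαβ, trace_kronecker, (hα i).2, (hβ i).2, one_mul]
    simp only [trace_smul, trace_sum, this, Complex.real_smul, mul_one,
      ← Complex.ofReal_sum, hw1] at hτ
    rw [Complex.ofReal_one, mul_one] at hτ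
    exact_mod_cast hτ
  let e := Fintype.equivFin ι
  refine ⟨Fintype.card ι, w ∘ e.symm, α ∘ e.symm, β ∘ e.symm, fun i ↦ hw _, ?_, fun i ↦ hα _,
    fun i ↦ hβ _, ?_⟩
  · rw [← hw1]; exact e.symm.sum_comp w
  · rw [ht, one_smul, ← e.symm.sum_comp]
    exact Finset.sum_congr rfl fun i _ ↦ by rw [hαβ]; rfl

theorem IsSeparableTwoQubit.posSemidef_partialTranspose
    {ρ : Matrix (Fin 2 × Fin 2) (Fin 2 × Fin 2) ℂ} (h : IsSeparableTwoQubit ρ) :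
    (partialTranspose ρ).PosSemidef := by
  obtain ⟨n, p, α, β, hp, -, hα, hβ, rfl⟩ := h
  have : partialTranspose (∑ i, (p i : ℂ) • (α i ⊗ₖ β i)) =
      ∑ i, p i • (α i ⊗ₖ (β i)ᵀ) := by
    ext x y
    simp [partialTranspose, Matrix.sum_apply]
  rw [this]
  exact posSemidef_sum _ fun i _ ↦ ((hα i).1.kronecker (hβ i).1.transpose).smul (hp i)

/-- A positive semidefinite matrix supported on `|01⟩, |10⟩, |11⟩` without coherence between
`|01⟩` and `|10⟩` is separable. -/
theorem mem_separableCone_of_apply_eq_zero {ρ : Matrix (Fin 2 × Fin 2) (Fin 2 × Fin 2) ℂ}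
    (hρ : ρ.PosSemidef) (h0 : ∀ x, ρ x (0, 0) = 0) (h1 : ρ (0, 1) (1, 0) = 0) :
    ρ ∈ separableCone := by
  have hT : ∀ x y, star (ρ y x) = ρ x y := fun x y ↦ hρ.1.apply x y
  set a := ρ (0, 1) (0, 1) with ha
  set b := ρ (1, 0) (1, 0) with hb
  set c := ρ (1, 1) (1, 1) with hc
  set x := ρ (0, 1) (1, 1) with hx
  set y := ρ (1, 0) (1, 1) with hy
  have ha0 : 0 ≤ a := hρ.diag_nonneg
  have has : star a = a := hT _ _
  have hbs : star b = b := hT _ _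
  have hcs : star c = c := hT _ _
  have hx' : ρ (1, 1) (0, 1) = star x := (hT _ _).symm
  have hy' : ρ (1, 1) (1, 0) = star y := (hT _ _).symm
  have h0' : ∀ z, ρ (0, 0) z = 0 := fun z ↦ by rw [← hT, h0, star_zero]
  have h1' : ρ (1, 0) (0, 1) = 0 := by rw [← hT, h1, star_zero]
  have hxa : a = 0 → x = 0 := fun h ↦ by
    have := (hρ.dotProduct_mulVec_zero_iff (Pi.single (0, 1) 1)).1 (by simpa using h)
    have := congrFun this (1, 1)
    simp only [mulVec_single_one, col_apply, Pi.zero_apply] at this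
    rw [hx, ← hT, this, star_zero]
  have hxa' : a * a⁻¹ * x = x := by
    by_cases h : a = 0
    · simp [hxa h]
    · rw [mul_inv_cancel₀ h, one_mul]
  have hM1 : (!![a, x; star x, a⁻¹ * (star x * x)]).PosSemidef := by
    convert (posSemidef_vecMulVec_self_star ![a, star x]).smul (inv_nonneg.2 ha0) using 1
    have hxa'' : star x * a * a⁻¹ = star x := by
      have := congrArg star hxa'
      simp only [star_mul', star_inv₀, has] at this
      linear_combination this
    ext i j
    rw [Matrix.smul_apply, vecMulVec_apply]
    fin_cases i <;> fin_cases j <;> simp [-Complex.star_def, has]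
    · by_cases h : a = 0
      · simp [h]
      · field_simp
    · linear_combination -hxa'
    · rw [Complex.star_def] at hxa''
      linear_combination -hxa''
  have hM2 : (!![b, y; star y, c - a⁻¹ * (star x * x)]).PosSemidef := by
    refine .of_dotProduct_mulVec_nonneg ?_ fun v ↦ ?_
    · ext i j
      fin_cases i <;> fin_cases j <;>
        simp [-Complex.star_def, hbs, hcs, has, mul_comm]
    · have := hρ.dotProduct_mulVec_nonneg (fun i ↦ !![0, - (a⁻¹ * x * v 1); v 0, v 1] i.1 i.2)
      convert this using 1
      simp [-Complex.star_def, dotProduct, mulVec, Fintype.sum_prod_type, Fin.sum_univ_two, h0,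
        h0', h1, h1', ← ha, ← hb, ← hc, ← hx, ← hy, hx', hy']
      linear_combination (-(v 1 * (starRingEnd ℂ) (v 1) * (starRingEnd ℂ) x *
        ((starRingEnd ℂ) a)⁻¹)) * hxa'
  have hE : (single 1 1 1 : Matrix (Fin 2) (Fin 2) ℂ).PosSemidef := by
    rw [← diagonal_single]
    refine .diagonal fun i ↦ ?_
    fin_cases i <;> simp
  have : ρ = !![a, x; star x, a⁻¹ * (star x * x)] ⊗ₖ single 1 1 1 +
      single 1 1 1 ⊗ₖ !![b, y; star y, c - a⁻¹ * (star x * x)] := by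
    ext ⟨i, j⟩ ⟨k, l⟩
    fin_cases i <;> fin_cases j <;> fin_cases k <;> fin_cases l <;>
    simp [h0, h0', h1, h1', ← ha, ← hb, ← hc, ← hx, ← hy, hx', hy']
  rw [this]
  exact add_mem (kronecker_mem_separableCone hM1 hE) (kronecker_mem_separableCone hE hM2)

end SeparableCone

section ProductKernel

theorem exists_isUnit_det_mulVec_eq {e : Fin 2 → ℂ} (he : e ≠ 0) :
    ∃ X : Matrix (Fin 2) (Fin 2) ℂ, IsUnit X.det ∧ X *ᵥ ![1, 0] = e ∧
      Xᴴᵀ *ᵥ ![1, 0] = star e := by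
  refine ⟨!![e 0, -star (e 1); e 1, star (e 0)], ?_, ?_, ?_⟩
  · rw [det_fin_two_of, isUnit_iff_ne_zero]
    intro h
    apply he
    have : ((‖e 0‖ ^ 2 + ‖e 1‖ ^ 2 : ℝ) : ℂ) = 0 := by
      push_cast
      rw [← Complex.mul_conj', ← Complex.mul_conj']
      simp only [Complex.star_def] at h
      linear_combination h
    have := Complex.ofReal_eq_zero.1 this
    ext i
    rw [Pi.zero_apply, ← norm_eq_zero]
    fin_cases i <;> simp only [Fin.zero_eta, Fin.mk_one] <;>
      nlinarith [sq_nonneg ‖e 0‖, sq_nonneg ‖e 1‖]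
  · ext i; fin_cases i <;> simp
  · ext i; fin_cases i <;> simp [mulVec, dotProduct]

theorem mem_separableCone_of_partialTranspose_mulVec_prodVec
    {ρ : Matrix (Fin 2 × Fin 2) (Fin 2 × Fin 2) ℂ} (hρ : ρ.PosSemidef) {e f : Fin 2 → ℂ}
    (he : e ≠ 0) (hf : f ≠ 0) (h : partialTranspose ρ *ᵥ prodVec e f = 0) :
    ρ ∈ separableCone := by
  have h' : ρ *ᵥ prodVec e (star f) = 0 := by
    rw [← hρ.dotProduct_mulVec_zero_iff, ← dotProduct_partialTranspose_mulVec_prodVec, h,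
      dotProduct_zero]
  obtain ⟨X, hX, hXe, -⟩ := exists_isUnit_det_mulVec_eq he
  obtain ⟨Y, hY, hYf, hYf'⟩ := exists_isUnit_det_mulVec_eq (star_ne_zero.2 hf)
  have hsingle : prodVec ![1, 0] ![1, 0] = Pi.single (0, 0) 1 := by
    ext ⟨i, j⟩
    fin_cases i <;> fin_cases j <;> simp [prodVec]
  set ρ' := (X ⊗ₖ Y)ᴴ * ρ * (X ⊗ₖ Y) with hρ'
  have hρ'0 : ρ' *ᵥ Pi.single (0, 0) 1 = 0 := by
    rw [← hsingle, hρ', ← mulVec_mulVec, kronecker_mulVec_prodVec, hXe, hYf, ← mulVec_mulVec, h',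
      mulVec_zero]
  have hΓ0 : partialTranspose ρ' *ᵥ Pi.single (0, 0) 1 = 0 := by
    rw [← hsingle, hρ', conjTranspose_kronecker, partialTranspose_kronecker_mul_mul,
      ← mulVec_mulVec, kronecker_mulVec_prodVec, hXe, hYf', star_star, ← mulVec_mulVec, h,
      mulVec_zero]
  have hpsd : ρ'.PosSemidef := hρ.conjTranspose_mul_mul_same _
  rw [mulVec_single_one] at hρ'0 hΓ0
  have hmem : ρ' ∈ separableCone := mem_separableCone_of_apply_eq_zero hpsd (congrFun hρ'0) (by
    have : ρ' (1, 0) (0, 1) = 0 := congrFun hΓ0 (1, 1)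
    rw [← hpsd.1.apply, this, star_zero])
  have hinv : (X ⊗ₖ Y) * (X⁻¹ ⊗ₖ Y⁻¹) = 1 := by
    rw [← mul_kronecker_mul, mul_nonsing_inv _ hX, mul_nonsing_inv _ hY, one_kronecker_one]
  have := kronecker_mul_mul_mem_separableCone hmem X⁻¹ Y⁻¹
  convert this using 1
  calc ρ = ((X ⊗ₖ Y) * (X⁻¹ ⊗ₖ Y⁻¹))ᴴ * ρ * ((X ⊗ₖ Y) * (X⁻¹ ⊗ₖ Y⁻¹)) := by simp [hinv]
    _ = _ := by rw [conjTranspose_mul, hρ']; simp only [Matrix.mul_assoc]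

theorem prodVec_factors_ne_zero {e f : Fin 2 → ℂ} (h : prodVec e f ≠ 0) : e ≠ 0 ∧ f ≠ 0 :=
  ⟨by rintro rfl; exact h (by ext; simp [prodVec]),
    by rintro rfl; exact h (by ext; simp [prodVec])⟩

theorem posSemidef_or_exists_prodVec_of_det_nonneg
    {ρ : Matrix (Fin 2 × Fin 2) (Fin 2 × Fin 2) ℂ} (hρ : ρ.PosSemidef)
    (hdet : 0 ≤ (partialTranspose ρ).det) :
    (partialTranspose ρ).PosSemidef ∨
      ∃ e f, e ≠ 0 ∧ f ≠ 0 ∧ partialTranspose ρ *ᵥ prodVec e f = 0 := by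
  have hH := hρ.1.partialTranspose
  set τ := partialTranspose ρ with hτ
  set μ := hH.eigenvalues with hμ
  by_cases hneg : ∀ i, 0 ≤ μ i
  · exact .inl (hH.posSemidef_iff_eigenvalues_nonneg.2 hneg)
  right
  push Not at hneg
  obtain ⟨i, hi⟩ := hneg
  obtain ⟨j, hji, hj⟩ : ∃ j, j ≠ i ∧ μ j ≤ 0 := by
    by_contra! hpos
    have hprod : 0 < ∏ j ∈ Finset.univ.erase i, μ j :=
      Finset.prod_pos fun j hj ↦ hpos j (Finset.ne_of_mem_erase hj)
    rw [hH.det_eq_prod_eigenvalues] at hdet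
    have : 0 ≤ ∏ j, μ j := by
      rw [← Complex.zero_le_real, Complex.ofReal_prod]
      exact hdet
    rw [← Finset.mul_prod_erase _ _ (Finset.mem_univ i)] at this
    nlinarith
  let u : Fin 2 × Fin 2 → Fin 2 × Fin 2 → ℂ := fun i ↦ hH.eigenvectorBasis i
  have hu : ∀ i, τ *ᵥ u i = (μ i : ℂ) • u i := fun i ↦ by
    have := hH.mulVec_eigenvectorBasis i
    rw [RCLike.real_smul_eq_coe_smul (K := ℂ)] at this
    exact this
  have horth : ∀ i j, star (u i) ⬝ᵥ u j = if i = j then 1 else 0 := fun i j ↦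
    congrFun (congrFun (Unitary.coe_star_mul_self hH.eigenvectorUnitary) i) j
  obtain ⟨a, b, hab, e, f, hef⟩ := exists_prodVec_mem_span_pair (u i) (u j)
  have hdot : ∀ x y : ℂ, star (a • u i + b • u j) ⬝ᵥ (x • u i + y • u j) =
      star a * x + star b * y := fun x y ↦ by
    simp [horth, hji, hji.symm, dotProduct_add, add_dotProduct, smul_dotProduct, dotProduct_smul]
    ring
  have hτw : τ *ᵥ prodVec e f = (a * μ i) • u i + (b * μ j) • u j := by
    rw [← hef, mulVec_add, mulVec_smul, mulVec_smul, hu, hu, smul_smul, smul_smul]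
  have hform : (star (prodVec e f) ⬝ᵥ τ *ᵥ prodVec e f).re = ‖a‖ ^ 2 * μ i + ‖b‖ ^ 2 * μ j := by
    rw [hτw, ← hef, hdot]
    have : star a * (a * μ i) + star b * (b * μ j) =
        ((‖a‖ ^ 2 * μ i + ‖b‖ ^ 2 * μ j : ℝ) : ℂ) := by
      push_cast
      rw [← Complex.mul_conj', ← Complex.mul_conj', Complex.star_def]
      ring
    rw [this, Complex.ofReal_re]
  have hnonneg : 0 ≤ ‖a‖ ^ 2 * μ i + ‖b‖ ^ 2 * μ j := by
    rw [← hform, hτ, dotProduct_partialTranspose_mulVec_prodVec]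
    exact hρ.re_nonneg _
  have hb0 : ‖b‖ ^ 2 * μ j ≤ 0 := mul_nonpos_of_nonneg_of_nonpos (sq_nonneg _) hj
  have ha : a = 0 := by
    by_contra ha
    have : 0 < ‖a‖ ^ 2 := by positivity
    nlinarith
  have hb : b ≠ 0 := hab.resolve_left (not_not_intro ha)
  have hμj : μ j = 0 := by
    have : 0 < ‖b‖ ^ 2 := by positivity
    rw [ha] at hnonneg
    simp only [norm_zero] at hnonneg
    nlinarith
  have hne : prodVec e f ≠ 0 := fun h0 ↦ hb (by
    have := hdot a b
    rw [hef, h0] at this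
    simpa [ha] using this)
  exact ⟨e, f, (prodVec_factors_ne_zero hne).1, (prodVec_factors_ne_zero hne).2, by
    rw [hτw, ha, hμj]; simp⟩

end ProductKernel

section PPT

theorem exists_ker_subset_span_singleton {ρ : Matrix (Fin 2 × Fin 2) (Fin 2 × Fin 2) ℂ}
    (h : ∀ e f, e ≠ 0 → f ≠ 0 → ρ *ᵥ prodVec e f ≠ 0) :
    ∃ k ≠ 0, ∀ v, ρ *ᵥ v = 0 → ∃ c : ℂ, c • k = v := by
  by_cases hk : ∃ k ≠ 0, ρ *ᵥ k = 0
  · obtain ⟨k, hk, hρk⟩ := hk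
    refine ⟨k, hk, fun v hv ↦ ?_⟩
    by_contra! hc
    have hind := (LinearIndependent.pair_iff' hk).2 hc
    obtain ⟨a, b, hab, e, f, hef⟩ := exists_prodVec_mem_span_pair k v
    have hne : prodVec e f ≠ 0 := by
      rw [← hef]
      intro h0
      have := LinearIndependent.pair_iff.1 hind a b h0
      tauto
    obtain ⟨he, hf⟩ := prodVec_factors_ne_zero hne
    refine h e f he hf ?_
    rw [← hef, mulVec_add, mulVec_smul, mulVec_smul, hρk, hv]
    simp
  · push Not at hk
    refine ⟨1, one_ne_zero, fun v hv ↦ ⟨0, ?_⟩⟩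
    by_contra hv0
    exact hk v (fun h0 ↦ hv0 (by simp [h0])) hv

/-- The real-linear parametrization `X ↦ (X + Xᵀ) + i (X - Xᵀ)` of Hermitian matrices. -/
def hermitianOfReal {n : Type*} (X : Matrix n n ℝ) : Matrix n n ℂ :=
  .of fun i j ↦ ⟨X i j + X j i, X i j - X j i⟩

theorem isHermitian_hermitianOfReal {n : Type*} (X : Matrix n n ℝ) :
    (hermitianOfReal X).IsHermitian := by
  ext i j
  apply Complex.ext <;> simp [hermitianOfReal, add_comm]

theorem hermitianOfReal_eq_zero {n : Type*} {X : Matrix n n ℝ} (h : hermitianOfReal X = 0) :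
    X = 0 := by
  ext i j
  have h1 := congrFun (congrFun h i) j
  have h2 := congrArg Complex.re h1
  have h3 := congrArg Complex.im h1
  simp only [hermitianOfReal, of_apply, Matrix.zero_apply, Complex.zero_re,
    Complex.zero_im] at h2 h3 ⊢
  linarith

theorem Matrix.IsHermitian.eq_zero_of_mulVec_add_smul {n : Type*} [Fintype n] {σ : Matrix n n ℂ}
    (hσ : σ.IsHermitian) {k : n → ℂ} (hk : k ≠ 0) {s : ℝ}
    (h : σ *ᵥ k + (s * Complex.I) • k = 0) : s = 0 := by
  have h1 := congrArg (fun v ↦ (star k ⬝ᵥ v).im) h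
  have h2 : (star k ⬝ᵥ σ *ᵥ k).im = 0 := hσ.im_star_dotProduct_mulVec_self k
  have h3 : 0 < star k ⬝ᵥ k := dotProduct_star_self_pos_iff.2 hk
  obtain ⟨h4, h5⟩ := Complex.lt_def.1 h3
  simp only [dotProduct_add, Complex.add_im, h2, dotProduct_smul, smul_eq_mul, Complex.mul_im,
    Complex.mul_re, Complex.ofReal_re, Complex.ofReal_im, Complex.I_re, Complex.I_im,
    dotProduct_zero, Complex.zero_im] at h1
  rw [← h5] at h1
  simp only [Complex.zero_re] at h4
  have : s * (star k ⬝ᵥ k).re = 0 := by simpa using h1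
  exact (mul_eq_zero.1 this).resolve_right h4.ne'

/-- Dimension count: two kernel conditions cost at most `7 + 7` of the `16` real dimensions of
Hermitian matrices, which leaves room for a traceless solution. -/
theorem exists_isHermitian_trace_eq_zero {k l : Fin 2 × Fin 2 → ℂ} (hk : k ≠ 0) (hl : l ≠ 0) :
    ∃ σ : Matrix (Fin 2 × Fin 2) (Fin 2 × Fin 2) ℂ, σ ≠ 0 ∧ σ.IsHermitian ∧ σ.trace = 0 ∧
      σ *ᵥ k = 0 ∧ partialTranspose σ *ᵥ l = 0 := by
  have hadd : ∀ X Y : Matrix (Fin 2 × Fin 2) (Fin 2 × Fin 2) ℝ,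
      hermitianOfReal (X + Y) = hermitianOfReal X + hermitianOfReal Y := fun X Y ↦ by
    ext i j; apply Complex.ext <;> simp [hermitianOfReal] <;> ring
  have hsmul : ∀ (c : ℝ) (X : Matrix (Fin 2 × Fin 2) (Fin 2 × Fin 2) ℝ),
      hermitianOfReal (c • X) = c • hermitianOfReal X := fun c X ↦ by
    ext i j; apply Complex.ext <;> simp [hermitianOfReal] <;> ring
  have pt_add : ∀ σ τ : Matrix (Fin 2 × Fin 2) (Fin 2 × Fin 2) ℂ,
      partialTranspose (σ + τ) = partialTranspose σ + partialTranspose τ := fun _ _ ↦ rfl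
  have pt_smul : ∀ (c : ℝ) (σ : Matrix (Fin 2 × Fin 2) (Fin 2 × Fin 2) ℂ),
      partialTranspose (c • σ) = c • partialTranspose σ := fun _ _ ↦ rfl
  have hI : ∀ (c s : ℝ) (v : Fin 2 × Fin 2 → ℂ),
      ((c * s : ℂ) * Complex.I) • v = c • (s * Complex.I) • v := fun c s v ↦ by
    rw [mul_assoc, mul_smul]; rfl
  let L : (Matrix (Fin 2 × Fin 2) (Fin 2 × Fin 2) ℝ × ℝ × ℝ) →ₗ[ℝ]
      ((Fin 2 × Fin 2 → ℂ) × (Fin 2 × Fin 2 → ℂ) × ℝ) :=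
    { toFun := fun p ↦ (hermitianOfReal p.1 *ᵥ k + (p.2.1 * Complex.I) • k,
        partialTranspose (hermitianOfReal p.1) *ᵥ l + (p.2.2 * Complex.I) • l,
        (hermitianOfReal p.1).trace.re)
      map_add' := fun p q ↦ by
        simp only [Prod.fst_add, Prod.snd_add, hadd, pt_add, add_mulVec, trace_add, Complex.add_re,
          Complex.ofReal_add, add_mul, add_smul, Prod.mk_add_mk]
        congr 1
        · abel
        · congr 1; abel
      map_smul' := fun c p ↦ by
        simp only [Prod.smul_fst, Prod.smul_snd, hsmul, pt_smul, smul_mulVec, trace_smul,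
          Complex.smul_re, smul_eq_mul, Complex.ofReal_mul, RingHom.id_apply, Prod.smul_mk,
          smul_add, hI] }
  have hker : LinearMap.ker L ≠ ⊥ := L.ker_ne_bot_of_finrank_lt (by
    simp [Module.finrank_prod, Module.finrank_matrix, Module.finrank_pi_fintype,
      Complex.finrank_real_complex])
  obtain ⟨⟨X, s, t⟩, hp, hp0⟩ := Submodule.exists_mem_ne_zero_of_ne_bot hker
  have hL : (_, _, _) = ((0 : Fin 2 × Fin 2 → ℂ), (0 : Fin 2 × Fin 2 → ℂ), (0 : ℝ)) := hp
  simp only [Prod.mk.injEq] at hL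
  obtain ⟨h1, h2, h3⟩ := hL
  have hX := isHermitian_hermitianOfReal X
  obtain rfl := hX.eq_zero_of_mulVec_add_smul hk h1
  obtain rfl := hX.partialTranspose.eq_zero_of_mulVec_add_smul hl h2
  refine ⟨hermitianOfReal X, fun h0 ↦ hp0 ?_, hX, Complex.ext h3 ?_, by simpa using h1,
    by simpa using h2⟩
  · rw [hermitianOfReal_eq_zero h0]; rfl
  · simp [trace, hermitianOfReal]

/-- Two-qubit positive semidefinite matrices with positive partial transpose are separable. -/
theorem mem_separableCone_of_posSemidef_partialTranspose
    {ρ : Matrix (Fin 2 × Fin 2) (Fin 2 × Fin 2) ℂ} (hρ : ρ.PosSemidef)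
    (hρΓ : (partialTranspose ρ).PosSemidef) : ρ ∈ separableCone := by
  induction hN : ρ.rank + (partialTranspose ρ).rank using Nat.strong_induction_on
    generalizing ρ with
  | _ N ih =>
  subst hN
  by_cases hΓ : ∃ e f, e ≠ 0 ∧ f ≠ 0 ∧ partialTranspose ρ *ᵥ prodVec e f = 0
  · obtain ⟨e, f, he, hf, h⟩ := hΓ
    exact mem_separableCone_of_partialTranspose_mulVec_prodVec hρ he hf h
  by_cases hker : ∃ e f, e ≠ 0 ∧ f ≠ 0 ∧ ρ *ᵥ prodVec e f = 0
  · obtain ⟨e, f, he, hf, h⟩ := hker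
    refine absurd ⟨e, star f, he, star_ne_zero.2 hf, ?_⟩ hΓ
    rw [← hρΓ.dotProduct_mulVec_zero_iff, dotProduct_partialTranspose_mulVec_prodVec, star_star, h,
      dotProduct_zero]
  push Not at hΓ hker
  obtain ⟨k, hk, hkρ⟩ := exists_ker_subset_span_singleton hker
  obtain ⟨l, hl, hlρ⟩ := exists_ker_subset_span_singleton hΓ
  obtain ⟨σ, hσ0, hσ, htr, hσk, hσl⟩ := exists_isHermitian_trace_eq_zero hk hl
  have h1 : ∀ v, ρ *ᵥ v = 0 → σ *ᵥ v = 0 := fun v hv ↦ by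
    obtain ⟨c, rfl⟩ := hkρ v hv
    rw [mulVec_smul, hσk, smul_zero]
  have h2 : ∀ v, partialTranspose ρ *ᵥ v = 0 → partialTranspose σ *ᵥ v = 0 := fun v hv ↦ by
    obtain ⟨c, rfl⟩ := hlρ v hv
    rw [mulVec_smul, hσl, smul_zero]
  obtain ⟨s, hs, hs1, hs2, hs3⟩ := exists_posSemidef_add_smul_rank_lt hρ hρΓ hσ
    (fun h ↦ hσ0 (h.trace_eq_zero_iff.1 htr)) h1 h2
  obtain ⟨t, ht, ht1, ht2, ht3⟩ := exists_posSemidef_add_smul_rank_lt (σ := -σ) hρ hρΓ hσ.neg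
    (fun h ↦ hσ0 (neg_eq_zero.1 (h.trace_eq_zero_iff.1 (by rw [trace_neg, htr, neg_zero]))))
    (fun v hv ↦ by rw [neg_mulVec, h1 v hv, neg_zero])
    (fun v hv ↦ by
      rw [show partialTranspose (-σ) = -partialTranspose σ from rfl, neg_mulVec, h2 v hv, neg_zero])
  have hcomb : ρ = (t / (s + t)) • (ρ + s • σ) + (s / (s + t)) • (ρ + t • -σ) := by
    have hst : t / (s + t) + s / (s + t) = 1 := by field_simp; ring
    calc ρ = (t / (s + t) + s / (s + t)) • ρ := by rw [hst, one_smul]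
      _ = _ := by module
  rw [hcomb]
  exact add_mem (smul_mem_separableCone (ih _ hs3 hs1 hs2 rfl) (by positivity))
    (smul_mem_separableCone (ih _ ht3 ht1 ht2 rfl) (by positivity))

end PPT

/-- **Peres–Horodecki criterion for two qubits via the determinant.**
A two-qubit density matrix `ρ` (4×4 complex, positive semidefinite, trace 1) is
separable if and only if `det(ρ^Γ) ≥ 0`, where `ρ^Γ` is the partial transpose
on the second qubit (the inequality is in the complex order: `det(ρ^Γ)` is real
and nonnegative). -/
theorem peres_horodecki_det_criterion
    (ρ : Matrix (Fin 2 × Fin 2) (Fin 2 × Fin 2) ℂ)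
    (hρ : ρ.PosSemidef) (hτ : ρ.trace = 1) :
    IsSeparableTwoQubit ρ ↔ 0 ≤ (partialTranspose ρ).det := by
  refine ⟨fun h ↦ h.posSemidef_partialTranspose.det_nonneg, fun h ↦
    isSeparableTwoQubit_of_mem_separableCone ?_ hτ⟩
  rcases posSemidef_or_exists_prodVec_of_det_nonneg hρ h with hΓ | ⟨e, f, he, hf, hef⟩
  · exact mem_separableCone_of_posSemidef_partialTranspose hρ hΓ
  · exact mem_separableCone_of_partialTranspose_mulVec_prodVec hρ he hf hef
end

section
/- Every separable two-qubit density matrix can be decomposed into at most four product terms: if ρ is a 4×4 complex positive semidefinite trace-1 matrix that is separable, then there exist m ≤ 4, reals p₁, …, p_m ≥ 0 with Σᵢ pᵢ = 1, and 2×2 complex positive semidefinite trace-1 matrices α₁, …, α_m and β₁, …, β_m such that ρ = Σ_{i=1}^{m} pᵢ αᵢ ⊗ βᵢ, where ⊗ is the Kronecker product. -/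
open Matrix Kronecker
open scoped ComplexOrder

/-- Perturbing a maximiser of `Re B(x, x)` on the unit sphere in an orthogonal direction `y`. -/
lemma bilin_eq_zero_of_re_le {E : Type*} [NormedAddCommGroup E] [InnerProductSpace ℂ E]
    (B : E →ₗ[ℂ] E →ₗ[ℂ] ℂ) (hB : ∀ x y, B x y = B y x) {u : E} (hu : ‖u‖ = 1)
    (hmax : ∀ x, (B x x).re ≤ (B u u).re * ‖x‖ ^ 2) {y : E} (hy : inner ℂ u y = 0) :
    B u y = 0 := by
  have key : ∀ z : E, inner ℂ u z = 0 → (B u z).re = 0 := by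
    intro z hz
    have hineq : ∀ t : ℝ, 2 * t * (B u z).re ≤ t ^ 2 * ((B u u).re * ‖z‖ ^ 2 - (B z z).re) := by
      intro t
      have h := hmax (u + (t : ℂ) • z)
      have hn : ‖u + (t : ℂ) • z‖ ^ 2 = 1 + t ^ 2 * ‖z‖ ^ 2 := by
        rw [@norm_add_sq ℂ, inner_smul_right, hz, norm_smul, hu]
        simp [mul_pow]
      rw [hn] at h
      simp only [map_add, map_smul, LinearMap.add_apply, LinearMap.smul_apply, smul_eq_mul,
        Complex.add_re, Complex.re_ofReal_mul, hB z u] at h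
      linarith
    set c := (B u z).re
    set C := (B u u).re * ‖z‖ ^ 2 - (B z z).re
    by_contra hc
    have hD : 0 < |C| + 1 := by positivity
    have h := hineq (c / (|C| + 1))
    have h2 : (c / (|C| + 1)) ^ 2 * C ≤ (c / (|C| + 1)) ^ 2 * (|C| + 1) := by
      gcongr
      linarith [le_abs_self C]
    have h3 : (c / (|C| + 1)) ^ 2 * (|C| + 1) = c ^ 2 / (|C| + 1) := by field_simp
    have h4 : 2 * (c / (|C| + 1)) * c = 2 * (c ^ 2 / (|C| + 1)) := by ring
    have h5 : 0 < c ^ 2 / (|C| + 1) := by positivity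
    linarith
  apply Complex.ext
  · simpa using key y hy
  · have := key (Complex.I • y) (by rw [inner_smul_right, hy, mul_zero])
    simpa using this

lemma exists_maximiser_re_bilin {E : Type*} [NormedAddCommGroup E] [InnerProductSpace ℂ E]
    [FiniteDimensional ℂ E] [Nontrivial E] (B : E →ₗ[ℂ] E →ₗ[ℂ] ℂ) :
    ∃ u : E, ‖u‖ = 1 ∧ ∀ x, (B x x).re ≤ (B u u).re * ‖x‖ ^ 2 := by
  have : ProperSpace E := FiniteDimensional.proper ℂ E
  have hcont : Continuous fun x : E => (B x x).re := by
    have h : Continuous fun x : E => LinearMap.toContinuousLinearMap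
        (LinearMap.toContinuousLinearMap.toLinearMap ∘ₗ B) x x := by fun_prop
    exact Complex.continuous_re.comp h
  obtain ⟨v, hv⟩ := exists_ne (0 : E)
  have hne : (Metric.sphere (0 : E) 1).Nonempty := by
    refine ⟨((‖v‖⁻¹ : ℝ) : ℂ) • v, ?_⟩
    simp [norm_smul, hv]
  obtain ⟨u, hu, hmax⟩ := (isCompact_sphere (0 : E) 1).exists_isMaxOn hne hcont.continuousOn
  refine ⟨u, by simpa using hu, fun x => ?_⟩
  by_cases hx : x = 0
  · simp [hx]
  have hx' : 0 < ‖x‖ := norm_pos_iff.mpr hx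
  have h := hmax (show ((‖x‖⁻¹ : ℝ) : ℂ) • x ∈ Metric.sphere (0 : E) 1 by simp [norm_smul, hx])
  simp only [Set.mem_ofPred_eq, map_smul, LinearMap.smul_apply, smul_eq_mul,
    Complex.re_ofReal_mul] at h
  calc (B x x).re = (‖x‖⁻¹ * (‖x‖⁻¹ * (B x x).re)) * ‖x‖ ^ 2 := by field_simp
    _ ≤ _ := by gcongr

/-- **Takagi factorisation**, padded by zero vectors to a family of prescribed length `d`. -/
lemma exists_orthogonal_frame_bilin_diagonal (d : ℕ) {E : Type*} [NormedAddCommGroup E]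
    [InnerProductSpace ℂ E] [FiniteDimensional ℂ E] (B : E →ₗ[ℂ] E →ₗ[ℂ] ℂ)
    (hB : ∀ x y, B x y = B y x) (hd : Module.finrank ℂ E ≤ d) :
    ∃ e : Fin d → E, (∀ i, ‖e i‖ = 1 ∨ e i = 0) ∧ (∀ i j, i ≠ j → inner ℂ (e i) (e j) = 0) ∧
      (∀ i j, i ≠ j → B (e i) (e j) = 0) ∧ ∀ x, ∑ i, inner ℂ (e i) x • e i = x := by
  induction d generalizing E with
  | zero =>
    have : Subsingleton E := Module.finrank_zero_iff.mp (Nat.le_zero.mp hd)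
    exact ⟨fun _ => 0, by simp, by simp, by simp, fun x => Subsingleton.elim _ _⟩
  | succ d ih =>
    rcases subsingleton_or_nontrivial E with h | h
    · exact ⟨fun _ => 0, by simp, by simp, by simp, fun x => Subsingleton.elim _ _⟩
    obtain ⟨u, hu, hmax⟩ := exists_maximiser_re_bilin B
    have hu0 : u ≠ 0 := by rintro rfl; simp at hu
    let F : Submodule ℂ E := (ℂ ∙ u)ᗮ
    have hF : Module.finrank ℂ F ≤ d := by
      have h1 := (ℂ ∙ u).finrank_add_finrank_orthogonal
      rw [finrank_span_singleton hu0] at h1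
      have : Module.finrank ℂ F = Module.finrank ℂ (ℂ ∙ u)ᗮ := rfl
      omega
    obtain ⟨e, hnorm, horth, hdiag, hsum⟩ :=
      ih (B.compl₁₂ F.subtype F.subtype) (fun x y => hB _ _) hF
    have huF : ∀ y : F, inner ℂ u (y : E) = 0 := fun y =>
      Submodule.mem_orthogonal_singleton_iff_inner_right.mp y.2
    have huB : ∀ y : F, B u y = 0 := fun y => bilin_eq_zero_of_re_le B hB hu hmax (huF y)
    refine ⟨Fin.cons u fun i => (e i : E), ?_, ?_, ?_, ?_⟩
    · refine Fin.cases (by simp [hu]) fun i => ?_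
      simpa using hnorm i
    · refine Fin.cases (Fin.cases (by simp) fun j _ => by simpa using huF (e j)) fun i =>
        Fin.cases (fun _ => ?_) fun j hij => ?_
      · simpa using inner_eq_zero_symm.mp (huF (e i))
      · simpa using horth i j (fun h => hij (by rw [h]))
    · refine Fin.cases (Fin.cases (by simp) fun j _ => by simpa using huB (e j)) fun i =>
        Fin.cases (fun _ => ?_) fun j hij => ?_
      · simpa [hB (e i : E) u] using huB (e i)
      · simpa using hdiag i j (fun h => hij (by rw [h]))
    · intro x
      have hmem : x - inner ℂ u x • u ∈ F := by
        refine Submodule.mem_orthogonal_singleton_iff_inner_right.mpr ?_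
        rw [inner_sub_right, inner_smul_right, inner_self_eq_norm_sq_to_K, hu]
        simp
      have h1 := congrArg (fun y : F => (y : E)) (hsum ⟨_, hmem⟩)
      have h2 : ∀ i, inner ℂ (e i : E) (x - inner ℂ u x • u) = inner ℂ (e i : E) x := by
        intro i
        rw [inner_sub_right, inner_smul_right, inner_eq_zero_symm.mp (huF (e i))]
        simp
      simp only [Submodule.coe_sum, Submodule.coe_smul, Submodule.coe_inner, h2] at h1
      rw [Fin.sum_univ_succ]
      simp [h1]

lemma exists_unit_mul_eq_norm (z : ℂ) : ∃ w : ℂ, ‖w‖ = 1 ∧ w * z = ‖z‖ := by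
  by_cases hz : z = 0
  · exact ⟨1, by simp, by simp [hz]⟩
  · have hz' : (‖z‖ : ℂ) ≠ 0 := by simpa using hz
    refine ⟨‖z‖ / z, by simp [hz], by field_simp⟩

/-- The triangle with sides `a`, `b`, `r` closes up. -/
lemma exists_unit_triangle {a b r : ℝ} (hr : |a - b| ≤ r) (hr' : r ≤ a + b) :
    ∃ z w : ℂ, ‖z‖ = 1 ∧ ‖w‖ = 1 ∧ z * a + w * b = r := by
  let f : ℝ → ℝ := fun t => ‖(a : ℂ) + Complex.exp (t * Complex.I) * b‖
  have hf : ContinuousOn f (Set.Icc 0 Real.pi) := by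
    unfold f
    fun_prop
  have h0 : f 0 = a + b := by
    have : 0 ≤ a + b := (abs_nonneg _).trans (hr.trans hr')
    simp only [f, Complex.ofReal_zero, zero_mul, Complex.exp_zero, one_mul]
    rw [← Complex.ofReal_add, Complex.norm_real, Real.norm_of_nonneg this]
  have hpi : f Real.pi = |a - b| := by
    simp only [f, Complex.exp_pi_mul_I, neg_mul, one_mul, ← sub_eq_add_neg]
    rw [← Complex.ofReal_sub, Complex.norm_real, Real.norm_eq_abs]
  obtain ⟨t, -, ht⟩ := intermediate_value_Icc' Real.pi_pos.le hf
    (show r ∈ Set.Icc (f Real.pi) (f 0) by rw [h0, hpi]; exact ⟨hr, hr'⟩)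
  obtain ⟨w, hw, hw'⟩ := exists_unit_mul_eq_norm ((a : ℂ) + Complex.exp (t * Complex.I) * b)
  refine ⟨w, w * Complex.exp (t * Complex.I), hw, ?_, ?_⟩
  · rw [norm_mul, hw, Complex.norm_exp_ofReal_mul_I, one_mul]
  · rw [← ht, ← hw']
    ring

/-- Four complex numbers satisfying the polygon inequalities can be rotated to sum to zero. -/
lemma exists_unit_sq_quadrilateral (μ : Fin 4 → ℂ)
    (h : ∀ i, ‖μ i‖ ≤ ∑ j ∈ Finset.univ.erase i, ‖μ j‖) :
    ∃ z : Fin 4 → ℂ, (∀ i, ‖z i‖ = 1) ∧ ∑ i, z i ^ 2 * μ i = 0 := by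
  have h' : ∀ i, 2 * ‖μ i‖ ≤ ‖μ 0‖ + ‖μ 1‖ + ‖μ 2‖ + ‖μ 3‖ := by
    intro i
    have h1 := Finset.add_sum_erase Finset.univ (fun j => ‖μ j‖) (Finset.mem_univ i)
    rw [Fin.sum_univ_four] at h1
    linarith [h i]
  have n0 := norm_nonneg (μ 0)
  have n1 := norm_nonneg (μ 1)
  have n2 := norm_nonneg (μ 2)
  have n3 := norm_nonneg (μ 3)
  have h0 := h' 0
  have h1 := h' 1
  have h2 := h' 2
  have h3 := h' 3
  obtain ⟨a, b, ha, hb, hab⟩ := exists_unit_triangle (a := ‖μ 0‖) (b := ‖μ 1‖)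
    (r := max |‖μ 0‖ - ‖μ 1‖| |‖μ 2‖ - ‖μ 3‖|) (le_max_left _ _)
    (max_le (abs_le.mpr ⟨by linarith, by linarith⟩) (abs_le.mpr ⟨by linarith, by linarith⟩))
  obtain ⟨c, d, hc, hd, hcd⟩ := exists_unit_triangle (a := ‖μ 2‖) (b := ‖μ 3‖)
    (r := max |‖μ 0‖ - ‖μ 1‖| |‖μ 2‖ - ‖μ 3‖|) (le_max_right _ _)
    (max_le (abs_le.mpr ⟨by linarith, by linarith⟩) (abs_le.mpr ⟨by linarith, by linarith⟩))
  choose w hw hw' using fun i => exists_unit_mul_eq_norm (μ i)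
  have root : ∀ x : ℂ, ‖x‖ = 1 → ∃ z : ℂ, ‖z‖ = 1 ∧ z ^ 2 = x := by
    intro x hx
    obtain ⟨z, hz⟩ := IsAlgClosed.exists_pow_nat_eq x two_pos
    refine ⟨z, ?_, hz⟩
    rwa [← hz, norm_pow, pow_eq_one_iff_of_nonneg (norm_nonneg z) two_ne_zero] at hx
  choose z hz hz' using fun i => root ((![a, b, -c, -d] : Fin 4 → ℂ) i * w i) (by
    fin_cases i <;> simp [ha, hb, hc, hd, hw])
  refine ⟨z, hz, ?_⟩
  simp only [hz', mul_assoc, hw', Fin.sum_univ_four]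
  simp
  linear_combination hab - hcd

/-- The polarised determinant, whose isotropic vectors are the product vectors `a ⊗ b`. -/
def detBilin : (Fin 2 × Fin 2 → ℂ) →ₗ[ℂ] (Fin 2 × Fin 2 → ℂ) →ₗ[ℂ] ℂ :=
  LinearMap.mk₂ ℂ
    (fun v w => v (0, 0) * w (1, 1) + v (1, 1) * w (0, 0) - v (0, 1) * w (1, 0)
      - v (1, 0) * w (0, 1))
    (fun _ _ _ => by simp only [Pi.add_apply]; ring)
    (fun _ _ _ => by simp only [Pi.smul_apply, smul_eq_mul]; ring)
    (fun _ _ _ => by simp only [Pi.add_apply]; ring)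
    (fun _ _ _ => by simp only [Pi.smul_apply, smul_eq_mul]; ring)

lemma detBilin_apply (v w : Fin 2 × Fin 2 → ℂ) :
    detBilin v w = v (0, 0) * w (1, 1) + v (1, 1) * w (0, 0) - v (0, 1) * w (1, 0)
      - v (1, 0) * w (0, 1) := rfl

lemma detBilin_comm (v w : Fin 2 × Fin 2 → ℂ) : detBilin v w = detBilin w v := by
  simp only [detBilin_apply]
  ring

/-- A decomposition `V Vᴴ = ∑ wᵢ wᵢᴴ` into four vectors that diagonalise a symmetric bilinear
form; if the columns of `V` are isotropic, the diagonal satisfies the polygon inequalities. -/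
lemma exists_four_diagonal_vectors {ι κ : Type*} [Fintype ι] [Fintype κ] [DecidableEq ι]
    (hκ : Fintype.card κ ≤ 4)
    (B : (κ → ℂ) →ₗ[ℂ] (κ → ℂ) →ₗ[ℂ] ℂ) (hB : ∀ v w, B v w = B w v)
    (V : Matrix κ ι ℂ) (hV : ∀ k, B (V.col k) (V.col k) = 0) :
    ∃ w : Fin 4 → κ → ℂ, V * Vᴴ = ∑ i, vecMulVec (w i) (star (w i)) ∧
      (∀ i j, i ≠ j → B (w i) (w j) = 0) ∧
      ∀ i, ‖B (w i) (w i)‖ ≤ ∑ j ∈ Finset.univ.erase i, ‖B (w j) (w j)‖ := by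
  let T : EuclideanSpace ℂ ι →ₗ[ℂ] κ → ℂ :=
    V.mulVecLin ∘ₗ (WithLp.linearEquiv 2 ℂ (ι → ℂ)).toLinearMap
  have hTsingle : ∀ k, T (EuclideanSpace.single k 1) = V.col k := by
    intro k
    ext x
    simp [T]
  let K : Submodule ℂ (EuclideanSpace ℂ ι) := T.kerᗮ
  have hK : Module.finrank ℂ K ≤ 4 := by
    have h1 := T.ker.finrank_add_finrank_orthogonal
    have h2 := T.finrank_range_add_finrank_ker
    have h3 := T.range.finrank_le
    rw [Module.finrank_fintype_fun_eq_card] at h3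
    change Module.finrank ℂ T.kerᗮ ≤ 4
    omega
  obtain ⟨e, hnorm, horth, hdiag, hsum⟩ := exists_orthogonal_frame_bilin_diagonal 4
    (B.compl₁₂ (T ∘ₗ K.subtype) (T ∘ₗ K.subtype)) (fun _ _ => hB _ _) hK
  let w : Fin 4 → κ → ℂ := fun i => T (e i)
  have hTsum : ∀ x, T x = ∑ i, inner ℂ (e i : EuclideanSpace ℂ ι) x • w i := by
    intro x
    have h1 : T x = T (K.starProjection x) := by
      have : x - K.starProjection x ∈ T.ker := by
        have h := K.sub_starProjection_mem_orthogonal x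
        rwa [Submodule.orthogonal_orthogonal] at h
      rw [LinearMap.mem_ker, map_sub, sub_eq_zero] at this
      exact this
    have h2 := congrArg (fun y : K => T y) (hsum (K.orthogonalProjectionOnto x))
    simp only [Submodule.coe_sum, map_sum, Submodule.coe_smul, map_smul] at h2
    rw [h1, K.starProjection_apply, ← h2]
    refine Finset.sum_congr rfl fun i _ => ?_
    rw [Submodule.inner_orthogonalProjectionOnto_eq_of_mem_left]
  have hcol : ∀ k, V.col k = ∑ i, star ((e i : EuclideanSpace ℂ ι) k) • w i := by
    intro k
    rw [← hTsingle, hTsum]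
    simp [EuclideanSpace.inner_single_right]
  have hw : ∀ i, inner ℂ (e i : EuclideanSpace ℂ ι) (e i) • w i = w i := by
    intro i
    rcases hnorm i with h | h
    · rw [inner_self_eq_norm_sq_to_K]
      simp only [Submodule.coe_norm] at h
      simp [h]
    · simp [w, h]
  have hdiag' : ∀ i j, i ≠ j → B (w i) (w j) = 0 := fun i j hij => hdiag i j hij
  refine ⟨w, ?_, hdiag', ?_⟩
  · ext x y
    have hVe : ∀ x k, V x k = ∑ i, star ((e i : EuclideanSpace ℂ ι) k) * w i x := by
      intro x k
      simpa using congrFun (hcol k) x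
    have hin : ∀ i j, ∑ k, star ((e i : EuclideanSpace ℂ ι) k) * (e j : EuclideanSpace ℂ ι) k
        = inner ℂ (e i : EuclideanSpace ℂ ι) (e j) := by
      intro i j
      simp [EuclideanSpace.inner_eq_star_dotProduct, dotProduct, mul_comm]
    calc (V * Vᴴ) x y
        = ∑ k, ∑ i, ∑ j, star ((e i : EuclideanSpace ℂ ι) k) * (e j : EuclideanSpace ℂ ι) k
            * (w i x * star (w j y)) := by
          simp only [mul_apply, conjTranspose_apply, hVe, star_sum, star_mul', star_star,
            Finset.sum_mul_sum]
          refine Finset.sum_congr rfl fun k _ => Finset.sum_congr rfl fun i _ =>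
            Finset.sum_congr rfl fun j _ => by ring
      _ = ∑ i, ∑ j, inner ℂ (e i : EuclideanSpace ℂ ι) (e j) * (w i x * star (w j y)) := by
          rw [Finset.sum_comm]
          refine Finset.sum_congr rfl fun i _ => ?_
          rw [Finset.sum_comm]
          refine Finset.sum_congr rfl fun j _ => ?_
          rw [← Finset.sum_mul, hin]
      _ = ∑ i, w i x * star (w i y) := by
          refine Finset.sum_congr rfl fun i _ => ?_
          rw [Finset.sum_eq_single i]
          · have := congrFun (hw i) x
            simp only [Pi.smul_apply, smul_eq_mul] at this
            rw [← mul_assoc, this]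
          · intro j _ hji
            have : inner ℂ (e i : EuclideanSpace ℂ ι) (e j) = 0 := horth i j hji.symm
            rw [this, zero_mul]
          · simp
      _ = _ := by simp [Matrix.sum_apply, vecMulVec_apply]
  · have hμ : ∀ i, (∑ k, ‖(e i : EuclideanSpace ℂ ι) k‖ ^ 2) * ‖B (w i) (w i)‖
        = ‖B (w i) (w i)‖ := by
      intro i
      rw [← EuclideanSpace.norm_sq_eq]
      rcases hnorm i with h | h
      · simp only [Submodule.coe_norm] at h
        simp [h]
      · simp [w, h]
    have hzero : ∀ k, ∑ i, star ((e i : EuclideanSpace ℂ ι) k) ^ 2 * B (w i) (w i) = 0 := by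
      intro k
      rw [← hV k, hcol k]
      simp only [map_sum, LinearMap.sum_apply, map_smul, LinearMap.smul_apply, smul_eq_mul]
      refine Finset.sum_congr rfl fun i _ => ?_
      rw [Finset.sum_eq_single i]
      · ring
      · intro j _ hji
        simp [hdiag' j i hji]
      · simp
    intro i
    rw [← hμ i, Finset.sum_congr rfl fun j _ => (hμ j).symm]
    simp only [Finset.sum_mul]
    rw [Finset.sum_comm]
    refine Finset.sum_le_sum fun k _ => ?_
    have h := hzero k
    rw [← Finset.add_sum_erase _ _ (Finset.mem_univ i)] at h
    have h2 := norm_sum_le (Finset.univ.erase i)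
      (fun j => star ((e j : EuclideanSpace ℂ ι) k) ^ 2 * B (w j) (w j))
    rw [← neg_eq_of_add_eq_zero_right h, norm_neg] at h2
    simpa using h2

/-- Four vectors that diagonalise `B` and satisfy the polygon inequalities can be replaced by
isotropic ones: adjust the phases, then mix with a Hadamard matrix. -/
lemma exists_four_isotropic_vectors {κ : Type*} (B : (κ → ℂ) →ₗ[ℂ] (κ → ℂ) →ₗ[ℂ] ℂ)
    (w : Fin 4 → κ → ℂ) (hdiag : ∀ i j, i ≠ j → B (w i) (w j) = 0)
    (hpoly : ∀ i, ‖B (w i) (w i)‖ ≤ ∑ j ∈ Finset.univ.erase i, ‖B (w j) (w j)‖) :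
    ∃ v : Fin 4 → κ → ℂ, (∀ i, B (v i) (v i) = 0) ∧
      ∑ i, vecMulVec (v i) (star (v i)) = ∑ i, vecMulVec (w i) (star (w i)) := by
  obtain ⟨z, hz, hsum⟩ := exists_unit_sq_quadrilateral _ hpoly
  have hz' : ∀ i, z i * star (z i) = 1 := by
    intro i
    have := Complex.mul_conj' (z i)
    rw [hz i] at this
    simpa using this
  let H : Matrix (Fin 4) (Fin 4) ℂ := !![1, 1, 1, 1; 1, 1, -1, -1; 1, -1, 1, -1; 1, -1, -1, 1]
  refine ⟨fun k => (1 / 2 : ℂ) • ∑ j, (H k j * z j) • w j, ?_, ?_⟩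
  · intro k
    have hH : ∀ j, H k j ^ 2 = 1 := by
      intro j
      fin_cases k <;> fin_cases j <;> simp [H]
    have : B (∑ j, (H k j * z j) • w j) (∑ j, (H k j * z j) • w j) = 0 := by
      rw [← hsum]
      simp only [map_sum, LinearMap.sum_apply, map_smul, LinearMap.smul_apply, smul_eq_mul]
      refine Finset.sum_congr rfl fun i _ => ?_
      rw [Finset.sum_eq_single i]
      · linear_combination (z i ^ 2 * B (w i) (w i)) * hH i
      · intro j _ hji
        simp [hdiag j i hji]
      · simp
    simp only [map_smul, LinearMap.smul_apply, this, smul_zero]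
  · ext x y
    have h0 := hz' 0
    have h1 := hz' 1
    have h2 := hz' 2
    have h3 := hz' 3
    simp only [Matrix.sum_apply, vecMulVec_apply, Pi.star_apply, Fin.sum_univ_four, Pi.smul_apply,
      Pi.add_apply, smul_eq_mul, star_mul', star_add]
    simp [H] at h0 h1 h2 h3 ⊢
    linear_combination (w 0 x * starRingEnd ℂ (w 0 y)) * h0 + (w 1 x * starRingEnd ℂ (w 1 y)) * h1
      + (w 2 x * starRingEnd ℂ (w 2 y)) * h2 + (w 3 x * starRingEnd ℂ (w 3 y)) * h3

lemma exists_product_of_detBilin_eq_zero {v : Fin 2 × Fin 2 → ℂ} (hv : detBilin v v = 0) :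
    ∃ a b : Fin 2 → ℂ, ∀ x y, v (x, y) = a x * b y := by
  have hdet : v (0, 0) * v (1, 1) = v (0, 1) * v (1, 0) := by
    rw [detBilin_apply] at hv
    linear_combination hv / 2
  by_cases h : ∃ x y, v (x, y) ≠ 0
  · obtain ⟨x₀, y₀, h⟩ := h
    refine ⟨fun x => v (x, y₀), fun y => v (x₀, y) / v (x₀, y₀), fun x y => ?_⟩
    field_simp
    fin_cases x₀ <;> fin_cases y₀ <;> fin_cases x <;> fin_cases y <;> simp <;>
      first | ring1 | linear_combination hdet | linear_combination -hdet
  · push Not at h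
    exact ⟨0, 0, fun x y => by simp [h x y]⟩

lemma exists_density_of_vector (a : Fin 2 → ℂ) :
    ∃ (p : ℝ) (α : Matrix (Fin 2) (Fin 2) ℂ), 0 ≤ p ∧ (α.PosSemidef ∧ α.trace = 1) ∧
      vecMulVec a (star a) = (p : ℂ) • α := by
  have hps := posSemidef_vecMulVec_self_star a
  set A := vecMulVec a (star a) with hA
  have htr : 0 ≤ A.trace := hps.trace_nonneg
  obtain ⟨p, hp, hpA⟩ : ∃ p : ℝ, 0 ≤ p ∧ A.trace = p :=
    ⟨A.trace.re, (Complex.nonneg_iff.mp htr).1, Complex.ext rfl (by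
      simpa using (Complex.nonneg_iff.mp htr).2.symm)⟩
  rcases hp.eq_or_lt with rfl | hp'
  · refine ⟨0, diagonal ![1, 0], le_rfl, ⟨?_, by simp [trace]⟩, ?_⟩
    · refine PosSemidef.diagonal fun i => ?_
      fin_cases i <;> simp
    · have := hps.trace_eq_zero_iff.mp (by simpa using hpA)
      simp [this]
  · have hp0 : (p : ℂ) ≠ 0 := by exact_mod_cast hp'.ne'
    refine ⟨p, ((p⁻¹ : ℝ) : ℂ) • A, hp, ⟨hps.smul ?_, ?_⟩, ?_⟩
    · exact_mod_cast (inv_pos.mpr hp').le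
    · simp [trace_smul, hpA, hp0]
    · simp [smul_smul, hp0]

lemma exists_density_product_of_detBilin_eq_zero {v : Fin 2 × Fin 2 → ℂ}
    (hv : detBilin v v = 0) :
    ∃ (p : ℝ) (α β : Matrix (Fin 2) (Fin 2) ℂ), 0 ≤ p ∧ (α.PosSemidef ∧ α.trace = 1) ∧
      (β.PosSemidef ∧ β.trace = 1) ∧ vecMulVec v (star v) = (p : ℂ) • (α ⊗ₖ β) := by
  obtain ⟨a, b, hab⟩ := exists_product_of_detBilin_eq_zero hv
  obtain ⟨p, α, hp, hα, ha⟩ := exists_density_of_vector a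
  obtain ⟨q, β, hq, hβ, hb⟩ := exists_density_of_vector b
  refine ⟨p * q, α, β, mul_nonneg hp hq, hα, hβ, ?_⟩
  have h : vecMulVec v (star v) = vecMulVec a (star a) ⊗ₖ vecMulVec b (star b) := by
    ext ⟨x, y⟩ ⟨x', y'⟩
    simp only [vecMulVec_apply, kroneckerMap_apply, Pi.star_apply, hab, star_mul']
    ring
  rw [h, ha, hb, smul_kronecker, kronecker_smul, smul_smul, Complex.ofReal_mul]

open MatrixOrder in
lemma Matrix.PosSemidef.exists_eq_mul_conjTranspose {A : Matrix (Fin 2) (Fin 2) ℂ}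
    (hA : A.PosSemidef) : ∃ C : Matrix (Fin 2) (Fin 2) ℂ, A = C * Cᴴ := by
  obtain ⟨C, hC⟩ := CStarAlgebra.nonneg_iff_eq_star_mul_self.mp hA.nonneg
  exact ⟨Cᴴ, by simpa [star_eq_conjTranspose] using hC⟩

lemma IsSeparableTwoQubit.exists_isotropic_columns
    {ρ : Matrix (Fin 2 × Fin 2) (Fin 2 × Fin 2) ℂ} (hρ : IsSeparableTwoQubit ρ) :
    ∃ (n : ℕ) (V : Matrix (Fin 2 × Fin 2) (Fin n × Fin 2 × Fin 2) ℂ),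
      (∀ k, detBilin (V.col k) (V.col k) = 0) ∧ ρ = V * Vᴴ := by
  obtain ⟨n, p, α, β, hp, -, hα, hβ, rfl⟩ := hρ
  choose C hC using fun i => (hα i).1.exists_eq_mul_conjTranspose
  choose D hD using fun i => (hβ i).1.exists_eq_mul_conjTranspose
  refine ⟨n, of fun x k => (√(p k.1) : ℂ) * (C k.1 ⊗ₖ D k.1) x k.2, fun k => ?_, ?_⟩
  · simp only [detBilin_apply, col_apply, of_apply, kroneckerMap_apply]
    ring
  · ext x y
    rw [Matrix.sum_apply, mul_apply, Fintype.sum_prod_type]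
    refine Finset.sum_congr rfl fun i _ => ?_
    have hs : (√(p i) : ℂ) * √(p i) = p i := by
      rw [← Complex.ofReal_mul, Real.mul_self_sqrt (hp i)]
    rw [hC i, hD i, mul_kronecker_mul, ← conjTranspose_kronecker, Matrix.smul_apply, mul_apply,
      smul_eq_mul, Finset.mul_sum]
    refine Finset.sum_congr rfl fun k _ => ?_
    rw [← hs]
    simp only [conjTranspose_apply, of_apply, star_mul', Complex.star_def, Complex.conj_ofReal]
    ring

/-- **Every separable two-qubit density matrix decomposes into at most four
product terms:** if `ρ` is a 4×4 complex positive semidefinite trace-1 matrix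
that is separable, then `ρ = Σᵢ pᵢ αᵢ ⊗ βᵢ` for some `m ≤ 4` terms, with
`pᵢ ≥ 0`, `Σᵢ pᵢ = 1`, and `αᵢ, βᵢ` 2×2 positive semidefinite trace-1 matrices. -/
theorem separable_two_qubit_four_terms
    (ρ : Matrix (Fin 2 × Fin 2) (Fin 2 × Fin 2) ℂ)
    (hρ : ρ.PosSemidef) (hτ : ρ.trace = 1)
    (hsep : IsSeparableTwoQubit ρ) :
    ∃ (m : ℕ), m ≤ 4 ∧
      ∃ (p : Fin m → ℝ) (α β : Fin m → Matrix (Fin 2) (Fin 2) ℂ),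
        (∀ i, 0 ≤ p i) ∧ (∑ i, p i = 1) ∧
        (∀ i, (α i).PosSemidef ∧ (α i).trace = 1) ∧
        (∀ i, (β i).PosSemidef ∧ (β i).trace = 1) ∧
        ρ = ∑ i, (p i : ℂ) • (α i ⊗ₖ β i) := by
  obtain ⟨n, V, hV, hρV⟩ := hsep.exists_isotropic_columns
  obtain ⟨w, hw, hdiag, hpoly⟩ :=
    exists_four_diagonal_vectors (by simp) detBilin detBilin_comm V hV
  obtain ⟨v, hv, hvw⟩ := exists_four_isotropic_vectors detBilin w hdiag hpoly
  choose p α β hp hα hβ hprod using fun i => exists_density_product_of_detBilin_eq_zero (hv i)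
  have hdecomp : ρ = ∑ i, (p i : ℂ) • (α i ⊗ₖ β i) := by
    rw [hρV, hw, ← hvw]
    exact Finset.sum_congr rfl fun i _ => hprod i
  refine ⟨4, le_rfl, p, α, β, hp, ?_, hα, hβ, hdecomp⟩
  rw [hdecomp, trace_sum] at hτ
  simp only [trace_smul, trace_kronecker, (hα _).2, (hβ _).2, mul_one, smul_eq_mul] at hτ
  exact_mod_cast hτ
end
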